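/- Let G = (V, Σ, P) be a context-free grammar, k ∈ ℕ, and let G^{≤k} be its unfolding. For every X ∈ V and 0 ≤ d ≤ k, there is a yield-preserving bijection between the set of (G^{≤k}, X^{=d})-derivation trees and the set of (G,X)-derivation trees of dimension exactly d, and a yield-preserving bijection between the set of (G^{≤k}, X^{≤d})-derivation trees and the set of (G,X)-derivation trees of dimension at most d. -/

import Mathlib

/-- A context-free grammar over variables `V` and terminal alphabet `A`:
a set of productions `X → rhs` with `rhs ∈ (A ⊕ V)*`. -/
structure CFG (V : Type) (A : Type) where
  P : Set (V × List (A ⊕ V))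

/-- The list of variable occurrences (in order) in a sentential form. -/
def varsOf {V A : Type} (rhs : List (A ⊕ V)) : List V :=
  rhs.filterMap Sum.getRight?

/-- Raw derivation trees: each node is labeled by a variable and a right-hand side,
and carries the list of subtrees (one per variable occurrence of the rhs). -/
inductive RawTree (V A : Type) : Type where
  | node (X : V) (rhs : List (A ⊕ V)) (children : List (RawTree V A)) : RawTree V A

namespace RawTree

/-- `IsDTree G X t` : `t` is a `(G,X)`-derivation tree. -/
inductive IsDTree {V A : Type} (G : CFG V A) : V → RawTree V A → Prop where
  | node {X : V} {rhs : List (A ⊕ V)} {children : List (RawTree V A)}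
      (hP : (X, rhs) ∈ G.P)
      (hch : List.Forall₂ (IsDTree G) (varsOf rhs) children) :
      IsDTree G X (RawTree.node X rhs children)

/-- Helper for `yield`: interleave the terminals of a rhs with the yields of the
subtrees (consumed in order, one per variable occurrence). -/
def yieldAux {V A : Type} : List (A ⊕ V) → List (List A) → List A
  | [], _ => []
  | (Sum.inl a) :: rest, ys => a :: yieldAux rest ys
  | (Sum.inr _) :: rest, [] => yieldAux rest []
  | (Sum.inr _) :: rest, y :: ys => y ++ yieldAux rest ys

/-- The yield of a derivation tree. -/
def yield {V A : Type} : RawTree V A → List A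
  | .node _ rhs cs => yieldAux rhs (cs.attach.map (fun c => yield c.1))
decreasing_by have := List.sizeOf_lt_of_mem c.2; simp; omega

/-- The dimension (Horton–Strahler number) of a tree. -/
def dim {V A : Type} : RawTree V A → ℕ
  | .node _ _ cs =>
    let ds := cs.attach.map (fun c => dim c.1)
    if ds.isEmpty then 0
    else
      let d := ds.foldr max 0
      if ds.count d = 1 then d else d + 1
decreasing_by have := List.sizeOf_lt_of_mem c.2; simp; omega

/-- The set of variables occurring as left-hand side of a label of some node of `t`. -/
def lhsVars {V A : Type} [DecidableEq V] : RawTree V A → Finset V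
  | .node X _ cs => insert X ((cs.attach.map (fun c => lhsVars c.1)).foldr (· ∪ ·) ∅)
decreasing_by have := List.sizeOf_lt_of_mem c.2; simp; omega

/-- `l(t)`: the number of distinct variables labelling (as lhs) the nodes of `t`. -/
def numLhsVars {V A : Type} [DecidableEq V] (t : RawTree V A) : ℕ := (lhsVars t).card

end RawTree

open RawTree

/-- The Parikh image of a word. -/
noncomputable def parikh {A : Type} (w : List A) : A →₀ ℕ :=
  (w.map (fun a => Finsupp.single a 1)).sum

/-- The ambiguity of `(G,X)` at a word `w`: the number of `(G,X)`-derivation trees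
with yield `w`, as an extended natural number. -/
noncomputable def amb {V A : Type} (G : CFG V A) (X : V) (w : List A) : ℕ∞ :=
  Set.encard {t : RawTree V A | IsDTree G X t ∧ yield t = w}

/-- The commutative ambiguity of `(G,X)` at a Parikh vector `v`: the number of
`(G,X)`-derivation trees whose yield has Parikh image `v`. -/
noncomputable def camb {V A : Type} (G : CFG V A) (X : V) (v : A →₀ ℕ) : ℕ∞ :=
  Set.encard {t : RawTree V A | IsDTree G X t ∧ parikh (yield t) = v}

/-- One rewriting step of `G` on sentential forms. -/
def Produces {V A : Type} (G : CFG V A) (α β : List (A ⊕ V)) : Prop :=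
  ∃ pre post X rhs, (X, rhs) ∈ G.P ∧
    α = pre ++ Sum.inr X :: post ∧ β = pre ++ rhs ++ post

/-- Derivation in one or more steps (`⇒⁺`). -/
def DerivesPlus {V A : Type} (G : CFG V A) : List (A ⊕ V) → List (A ⊕ V) → Prop :=
  Relation.TransGen (Produces G)

/-- Derivation in zero or more steps (`⇒*`). -/
def Derives {V A : Type} (G : CFG V A) : List (A ⊕ V) → List (A ⊕ V) → Prop :=
  Relation.ReflTransGen (Produces G)

/-- A grammar is nonexpansive if no variable `X` derives a sentential form
containing two or more occurrences of `X`. -/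
def Nonexpansive {V A : Type} [DecidableEq V] [DecidableEq A] (G : CFG V A) : Prop :=
  ∀ (X : V) (α : List (A ⊕ V)), DerivesPlus G [Sum.inr X] α → α.count (Sum.inr X) ≤ 1

/-! ### The unfolded grammar `G^{≤k}` -/

/-- Variables of the unfolded grammar: `UVar.le X d` stands for `X^{≤d}` and
`UVar.eq X d` stands for `X^{=d}`. -/
inductive UVar (V : Type) : Type where
  | le (X : V) (d : ℕ) : UVar V
  | eq (X : V) (d : ℕ) : UVar V
  deriving DecidableEq

/-- Replace, in order, each variable occurrence of `rhs` by the corresponding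
annotated variable from `zs` (terminals are kept). -/
def relabel {V A : Type} : List (A ⊕ V) → List (UVar V) → List (A ⊕ UVar V)
  | [], _ => []
  | (Sum.inl a) :: rest, zs => Sum.inl a :: relabel rest zs
  | (Sum.inr _) :: rest, [] => relabel rest []
  | (Sum.inr _) :: rest, z :: zs => Sum.inr z :: relabel rest zs

/-- The productions of the unfolded grammar `G^{≤k}`. -/
def unfoldP {V A : Type} (G : CFG V A) (k : ℕ) : Set (UVar V × List (A ⊕ UVar V)) :=
  -- (1)  X^{≤d} → X^{=e}  for e ≤ d ≤ k
  { p | ∃ X d e, e ≤ d ∧ d ≤ k ∧ p = (UVar.le X d, [Sum.inr (UVar.eq X e)]) } ∪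
  -- (2)  X^{=0} → u₀  whenever X → u₀ with u₀ ∈ Σ*
  { p | ∃ X rhs, (X, rhs) ∈ G.P ∧ varsOf rhs = [] ∧
        p = (UVar.eq X 0, relabel rhs []) } ∪
  -- (3)  X^{=d} → u₀ X₁^{=d} u₁  whenever X → u₀X₁u₁ (one variable occurrence), d ≤ k
  { p | ∃ X rhs Y d, (X, rhs) ∈ G.P ∧ varsOf rhs = [Y] ∧ d ≤ k ∧
        p = (UVar.eq X d, relabel rhs [UVar.eq Y d]) } ∪
  -- (4a)
  { p | ∃ X rhs d j, (X, rhs) ∈ G.P ∧ 2 ≤ (varsOf rhs).length ∧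
        1 ≤ d ∧ d ≤ k ∧ j < (varsOf rhs).length ∧
        p = (UVar.eq X d, relabel rhs ((varsOf rhs).mapIdx (fun i Y =>
              if i = j then UVar.eq Y d else UVar.le Y (d - 1)))) } ∪
  -- (4b)
  { p | ∃ X rhs d, ∃ J : Finset ℕ, (X, rhs) ∈ G.P ∧ 2 ≤ (varsOf rhs).length ∧
        1 ≤ d ∧ d ≤ k ∧ 2 ≤ J.card ∧ (∀ i ∈ J, i < (varsOf rhs).length) ∧
        (2 ≤ d ∨ J = Finset.range (varsOf rhs).length) ∧
        p = (UVar.eq X d, relabel rhs ((varsOf rhs).mapIdx (fun i Y =>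
              if i ∈ J then UVar.eq Y (d - 1) else UVar.le Y (d - 2)))) }

/-- The unfolded grammar `G^{≤k}`. -/
def unfold {V A : Type} (G : CFG V A) (k : ℕ) : CFG (UVar V) A :=
  ⟨unfoldP G k⟩

namespace UVar

/-- The variable of the original grammar underlying an annotated variable. -/
def base {V : Type} : UVar V → V
  | le X _ => X
  | eq X _ => X

/-- The numerical annotation of an annotated variable. -/
def bound {V : Type} : UVar V → ℕ
  | le _ d => d
  | eq _ d => d

/-- `z.Admits n`: the annotation of `z` allows trees of dimension `n`. -/
def Admits {V : Type} : UVar V → ℕ → Prop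
  | le _ d, n => n ≤ d
  | eq _ d, n => n = d

end UVar

/-- The dimension of a node as a function of the dimensions of its children. -/
def nodeDim (ds : List ℕ) : ℕ :=
  if ds.isEmpty then 0
  else if ds.count (ds.foldr max 0) = 1 then ds.foldr max 0 else ds.foldr max 0 + 1

/-- `Annotates d ys zs`: the unfolded grammar has a production for `X^{=d}` in which the
variable occurrences `ys` of the original production are annotated as `zs`. -/
inductive Annotates {V : Type} : ℕ → List V → List (UVar V) → Prop
  | nil : Annotates 0 [] []
  | single (d : ℕ) (Y : V) : Annotates d [Y] [UVar.eq Y d]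
  | unique {d : ℕ} {ys : List V} {j : ℕ} (hlen : 2 ≤ ys.length) (hd : 1 ≤ d)
      (hj : j < ys.length) :
      Annotates d ys (ys.mapIdx fun i Y => if i = j then UVar.eq Y d else UVar.le Y (d - 1))
  | multiple {d : ℕ} {ys : List V} {J : Finset ℕ} (hlen : 2 ≤ ys.length) (hd : 1 ≤ d)
      (hcard : 2 ≤ J.card) (hJ : ∀ i ∈ J, i < ys.length)
      (hall : 2 ≤ d ∨ J = Finset.range ys.length) :
      Annotates d ys
        (ys.mapIdx fun i Y => if i ∈ J then UVar.eq Y (d - 1) else UVar.le Y (d - 2))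

/-- The annotation of `ys` determined by the dimension `d` of a node and the dimensions `ns`
of its children. -/
def annotation {V : Type} (d : ℕ) (ys : List V) (ns : List ℕ) : List (UVar V) :=
  if d ∈ ns then
    List.zipWith (fun Y n => if n = d then UVar.eq Y d else UVar.le Y (d - 1)) ys ns
  else
    List.zipWith (fun Y n => if n = d - 1 then UVar.eq Y (d - 1) else UVar.le Y (d - 2)) ys ns

theorem List.count_eq_card_filter_range_getElem? {α : Type*} [DecidableEq α] (l : List α) (a : α) :
    l.count a = ((Finset.range l.length).filter fun i => l[i]? = some a).card := by
  induction l using List.reverseRecOn with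
  | nil => simp
  | append_singleton l b ih =>
    have h : ((Finset.range l.length).filter fun i => (l ++ [b])[i]? = some a) =
        (Finset.range l.length).filter fun i => l[i]? = some a := by
      apply Finset.filter_congr
      intro i hi
      rw [List.getElem?_append_left (Finset.mem_range.mp hi)]
    rw [List.count_append, ih, List.length_append, List.length_singleton, Finset.range_add_one,
      Finset.filter_insert, h]
    by_cases hb : b = a <;> simp [hb]

theorem List.le_foldr_max {l : List ℕ} {n : ℕ} (h : n ∈ l) : n ≤ l.foldr max 0 := by
  induction l with
  | nil => simp at h
  | cons a l ih =>
    rcases List.mem_cons.mp h with rfl | h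
    · simp
    · have := ih h
      simp [this]

theorem List.foldr_max_mem {l : List ℕ} (h : l ≠ []) : l.foldr max 0 ∈ l := by
  induction l with
  | nil => simp at h
  | cons a l ih =>
    rcases eq_or_ne l [] with rfl | hl
    · simp
    · rcases max_choice a (l.foldr max 0) with h' | h'
      · simp [h']
      · simp [h', ih hl]

theorem List.foldr_max_eq {l : List ℕ} {m : ℕ} (hm : m ∈ l) (h : ∀ n ∈ l, n ≤ m) :
    l.foldr max 0 = m :=
  le_antisymm (h _ (List.foldr_max_mem (List.ne_nil_of_mem hm))) (List.le_foldr_max hm)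

theorem List.Forall₂.imp_of_mem_right {α β : Type*} {R S : α → β → Prop} {l : List α}
    {l' : List β} (h : List.Forall₂ R l l') (hRS : ∀ a, ∀ b ∈ l', R a b → S a b) :
    List.Forall₂ S l l' := by
  induction h with
  | nil => exact .nil
  | cons hab _ ih =>
    exact .cons (hRS _ _ (by simp) hab) (ih fun a b hb => hRS a b (by simp [hb]))

theorem Annotates.map_base {V : Type} {d : ℕ} {ys : List V} {zs : List (UVar V)}
    (h : Annotates d ys zs) : zs.map UVar.base = ys := by
  cases h with
  | nil => rfl
  | single => rfl
  | unique =>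
    apply List.ext_getElem (by simp)
    intro i _ _
    simp only [List.getElem_map, List.getElem_mapIdx]
    split_ifs <;> rfl
  | multiple =>
    apply List.ext_getElem (by simp)
    intro i _ _
    simp only [List.getElem_map, List.getElem_mapIdx]
    split_ifs <;> rfl

theorem forall₂_admits_mapIdx {V : Type} {ys : List V} {f : ℕ → V → UVar V} {ns : List ℕ} :
    List.Forall₂ UVar.Admits (ys.mapIdx f) ns ↔
      ∃ hl : ys.length = ns.length,
        ∀ i (hi : i < ns.length), (f i (ys[i]'(hl ▸ hi))).Admits ns[i] := by
  rw [List.forall₂_iff_get]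
  simp only [List.length_mapIdx, List.get_eq_getElem, List.getElem_mapIdx]
  constructor
  · rintro ⟨hl, h⟩
    exact ⟨hl, fun i hi => h i (hl ▸ hi) hi⟩
  · rintro ⟨hl, h⟩
    exact ⟨hl, fun i _ hi => h i hi⟩

theorem Annotates.nodeDim_eq {V : Type} {d : ℕ} {ys : List V} {zs : List (UVar V)} {ns : List ℕ}
    (h : Annotates d ys zs) (hns : List.Forall₂ UVar.Admits zs ns) : nodeDim ns = d := by
  cases h with
  | nil => cases hns; rfl
  | single =>
    rcases hns with _ | ⟨h, h'⟩
    cases h'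
    cases h
    simp [nodeDim]
  | @unique _ _ j hlen hd hj =>
    obtain ⟨hl, hns⟩ := forall₂_admits_mapIdx.mp hns
    have hjn : ns[j] = d := by simpa [UVar.Admits] using hns j (hl ▸ hj)
    have hne : ∀ i (hi : i < ns.length), i ≠ j → ns[i] ≤ d - 1 := fun i hi hij => by
      simpa [UVar.Admits, hij] using hns i hi
    have hmem : d ∈ ns := hjn ▸ List.getElem_mem _
    have hmax : ns.foldr max 0 = d := by
      refine List.foldr_max_eq hmem fun n hn => ?_
      obtain ⟨i, hi, rfl⟩ := List.getElem_of_mem hn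
      by_cases hij : i = j
      · subst hij; omega
      · have := hne i hi hij; omega
    have hcount : ns.count d = 1 := by
      rw [List.count_eq_card_filter_range_getElem?, Finset.card_eq_one]
      refine ⟨j, ?_⟩
      ext i
      simp only [Finset.mem_filter, Finset.mem_range, Finset.mem_singleton]
      constructor
      · rintro ⟨hi, h⟩
        by_contra hij
        have := hne i hi hij
        rw [List.getElem?_eq_getElem hi, Option.some_inj] at h
        omega
      · rintro rfl
        exact ⟨hl ▸ hj, by rw [List.getElem?_eq_getElem (hl ▸ hj), hjn]⟩
    have : ns ≠ [] := List.ne_nil_of_mem hmem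
    simp [nodeDim, hmax, hcount, this]
  | @multiple _ _ J hlen hd hcard hJ hall =>
    obtain ⟨hl, hns⟩ := forall₂_admits_mapIdx.mp hns
    have hin : ∀ i (hi : i < ns.length), i ∈ J → ns[i] = d - 1 := fun i hi hij => by
      simpa [UVar.Admits, hij] using hns i hi
    have hout : ∀ i (hi : i < ns.length), i ∉ J → ns[i] ≤ d - 2 := fun i hi hij => by
      simpa [UVar.Admits, hij] using hns i hi
    obtain ⟨j, hj⟩ : J.Nonempty := Finset.card_pos.mp (by omega)
    have hmem : d - 1 ∈ ns := hin j (hl ▸ hJ j hj) hj ▸ List.getElem_mem _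
    have hmax : ns.foldr max 0 = d - 1 := by
      refine List.foldr_max_eq hmem fun n hn => ?_
      obtain ⟨i, hi, rfl⟩ := List.getElem_of_mem hn
      by_cases hij : i ∈ J
      · have := hin i hi hij; omega
      · have := hout i hi hij; omega
    have hcount : 2 ≤ ns.count (d - 1) := by
      rw [List.count_eq_card_filter_range_getElem?]
      refine hcard.trans (Finset.card_le_card fun i hi => ?_)
      have hi' : i < ns.length := hl ▸ hJ i hi
      simp [hi', hin i hi' hi]
    have : ns ≠ [] := List.ne_nil_of_mem hmem
    have h1 : ns.count (d - 1) ≠ 1 := by omega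
    simp only [nodeDim, hmax, h1, if_false, List.isEmpty_iff, this]
    omega

theorem Annotates.eq_annotation {V : Type} {d : ℕ} {ys : List V} {zs : List (UVar V)}
    {ns : List ℕ} (h : Annotates d ys zs) (hns : List.Forall₂ UVar.Admits zs ns) :
    zs = annotation d ys ns := by
  cases h with
  | nil => cases hns; rfl
  | single =>
    rcases hns with _ | ⟨h, h'⟩
    cases h'
    cases h
    simp [annotation]
  | @unique _ _ j hlen hd hj =>
    obtain ⟨hl, hns⟩ := forall₂_admits_mapIdx.mp hns
    have hjn : ns[j] = d := by simpa [UVar.Admits] using hns j (hl ▸ hj)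
    have hmem : d ∈ ns := hjn ▸ List.getElem_mem _
    rw [annotation, if_pos hmem]
    apply List.ext_getElem (by simp [hl])
    intro i hi hi'
    have hin : i < ns.length := by simpa [hl] using hi
    simp only [List.getElem_mapIdx, List.getElem_zipWith]
    by_cases hij : i = j
    · subst hij; simp [hjn]
    · have : ns[i] ≤ d - 1 := by simpa [UVar.Admits, hij] using hns i hin
      have : ns[i] ≠ d := by omega
      simp [hij, this]
  | @multiple _ _ J hlen hd hcard hJ hall =>
    obtain ⟨hl, hns⟩ := forall₂_admits_mapIdx.mp hns
    have hin : ∀ i (hi : i < ns.length), i ∈ J → ns[i] = d - 1 := fun i hi hij => by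
      simpa [UVar.Admits, hij] using hns i hi
    have hout : ∀ i (hi : i < ns.length), i ∉ J → ns[i] ≤ d - 2 := fun i hi hij => by
      simpa [UVar.Admits, hij] using hns i hi
    have hmem : d ∉ ns := fun hn => by
      obtain ⟨i, hi, h⟩ := List.getElem_of_mem hn
      by_cases hij : i ∈ J
      · have := hin i hi hij; omega
      · have := hout i hi hij; omega
    rw [annotation, if_neg hmem]
    apply List.ext_getElem (by simp [hl])
    intro i hi hi'
    have hi : i < ns.length := by simpa [hl] using hi
    simp only [List.getElem_mapIdx, List.getElem_zipWith]
    by_cases hij : i ∈ J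
    · simp [hij, hin i hi hij]
    · have h2 : 2 ≤ d := hall.resolve_right fun h => hij (by simp [h, hl, hi])
      have := hout i hi hij
      have : ns[i] ≠ d - 1 := by omega
      simp [hij, this]

theorem exists_annotates {V : Type} {ys : List V} {ns : List ℕ} (hl : ys.length = ns.length) :
    ∃ zs, Annotates (nodeDim ns) ys zs ∧ List.Forall₂ UVar.Admits zs ns ∧
      ∀ z ∈ zs, z.bound ≤ nodeDim ns := by
  rcases lt_or_ge ys.length 2 with hlt | hlen
  · match ys, ns, hl with
    | [], [], _ => exact ⟨[], .nil, .nil, by simp⟩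
    | [Y], [n], _ =>
      have : nodeDim [n] = n := by simp [nodeDim]
      rw [this]
      exact ⟨_, .single n Y, .cons rfl .nil, by simp [UVar.bound]⟩
    | _ :: _ :: _, _, _ => simp at hlt
  have hne : ns ≠ [] := by rintro rfl; simp at hl; simp [hl] at hlen
  obtain ⟨m, hm⟩ : ∃ m, m = ns.foldr max 0 := ⟨_, rfl⟩
  have hmem : m ∈ ns := hm ▸ List.foldr_max_mem hne
  have hle : ∀ i (hi : i < ns.length), ns[i] ≤ m := fun i hi =>
    hm ▸ List.le_foldr_max (List.getElem_mem hi)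
  by_cases hc : ns.count m = 1
  · have hd : nodeDim ns = m := by simp [nodeDim, ← hm, hc, hne]
    rw [hd]
    rw [List.count_eq_card_filter_range_getElem?, Finset.card_eq_one] at hc
    obtain ⟨j, hj⟩ := hc
    have hiff : ∀ i (hi : i < ns.length), ns[i] = m ↔ i = j := fun i hi => by
      have := Finset.ext_iff.mp hj i
      simpa [hi] using this
    have hjl : j < ns.length := by
      have := (Finset.ext_iff.mp hj j).mpr (by simp)
      simpa using (Finset.mem_filter.mp this).1
    have hpos : 1 ≤ m := by
      obtain ⟨i, hi, hij⟩ : ∃ i, i < ns.length ∧ i ≠ j := by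
        rcases Nat.eq_zero_or_pos j with rfl | h
        · exact ⟨1, by omega, by omega⟩
        · exact ⟨0, by omega, by omega⟩
      have h1 := hle i hi
      have h2 := (hiff i hi).not.mpr hij
      omega
    refine ⟨_, .unique hlen hpos (hl ▸ hjl), forall₂_admits_mapIdx.mpr ⟨hl, fun i hi => ?_⟩, ?_⟩
    · have h1 := hle i hi
      have h2 := hiff i hi
      split_ifs with hij
      · exact h2.mpr hij
      · have := h2.not.mpr hij
        simp only [UVar.Admits]
        omega
    · intro z hz
      obtain ⟨i, hi, rfl⟩ := List.mem_mapIdx.mp hz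
      split_ifs <;> simp [UVar.bound]
  · have hd : nodeDim ns = m + 1 := by simp [nodeDim, ← hm, hc, hne]
    have hcpos : 0 < ns.count m := List.count_pos_iff.mpr hmem
    rw [hd]
    have hcard : 2 ≤ ((Finset.range ns.length).filter fun i => ns[i]? = some m).card := by
      rw [← List.count_eq_card_filter_range_getElem?]
      omega
    refine ⟨_, .multiple (J := (Finset.range ns.length).filter fun i => ns[i]? = some m) hlen
      (by omega) hcard (fun i hi => ?_) ?_,
      forall₂_admits_mapIdx.mpr ⟨hl, fun i hi => ?_⟩, ?_⟩
    · rw [hl]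
      exact Finset.mem_range.mp (Finset.mem_filter.mp hi).1
    · rcases Nat.eq_zero_or_pos m with h0 | h
      · right
        rw [hl]
        apply Finset.filter_true_of_mem
        intro i hi
        have hi := Finset.mem_range.mp hi
        have := hle i hi
        rw [List.getElem?_eq_getElem hi, Option.some_inj]
        omega
      · left; omega
    · have h1 := hle i hi
      simp only [Finset.mem_filter, Finset.mem_range, hi, List.getElem?_eq_getElem,
        Option.some_inj, true_and]
      split_ifs with hij
      · simpa [UVar.Admits] using hij
      · simp only [UVar.Admits]
        omega
    · intro z hz
      obtain ⟨i, hi, rfl⟩ := List.mem_mapIdx.mp hz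
      split_ifs <;> simp [UVar.bound]
      omega

theorem eq_mem_unfoldP {V A : Type} {G : CFG V A} {k d : ℕ} {X : V} {r : List (A ⊕ UVar V)} :
    (UVar.eq X d, r) ∈ unfoldP G k ↔
      d ≤ k ∧ ∃ rhs zs, (X, rhs) ∈ G.P ∧ Annotates d (varsOf rhs) zs ∧ r = relabel rhs zs := by
  constructor
  · rintro ((((⟨_, _, _, _, _, h⟩ | ⟨X', rhs, hP, hv, h⟩) | ⟨X', rhs, Y, d', hP, hv, hd, h⟩) |
      ⟨X', rhs, d', j, hP, hlen, hd, hdk, hj, h⟩) |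
      ⟨X', rhs, d', J, hP, hlen, hd, hdk, hc, hJ, hall, h⟩)
    · simp at h
    all_goals
      simp only [Prod.mk.injEq, UVar.eq.injEq] at h
      obtain ⟨⟨rfl, rfl⟩, rfl⟩ := h
    · exact ⟨Nat.zero_le _, rhs, _, hP, hv ▸ .nil, rfl⟩
    · exact ⟨hd, rhs, _, hP, hv ▸ .single _ _, rfl⟩
    · exact ⟨hdk, rhs, _, hP, .unique hlen hd hj, rfl⟩
    · exact ⟨hdk, rhs, _, hP, .multiple hlen hd hc hJ hall, rfl⟩
  · rintro ⟨hdk, rhs, zs, hP, h, rfl⟩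
    generalize hys : varsOf rhs = ys at h
    cases h with
    | nil => exact .inl (.inl (.inl (.inr ⟨X, rhs, hP, hys, rfl⟩)))
    | single _ Y => exact .inl (.inl (.inr ⟨X, rhs, Y, d, hP, hys, hdk, rfl⟩))
    | @unique _ _ j hlen hd hj =>
      subst hys
      exact .inl (.inr ⟨X, rhs, d, j, hP, hlen, hd, hdk, hj, rfl⟩)
    | @multiple _ _ J hlen hd hc hJ hall =>
      subst hys
      exact .inr ⟨X, rhs, d, J, hP, hlen, hd, hdk, hc, hJ, hall, rfl⟩

theorem le_mem_unfoldP {V A : Type} {G : CFG V A} {k d : ℕ} {X : V} {r : List (A ⊕ UVar V)} :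
    (UVar.le X d, r) ∈ unfoldP G k ↔ d ≤ k ∧ ∃ e ≤ d, r = [Sum.inr (UVar.eq X e)] := by
  constructor
  · rintro ((((⟨_, _, e, he, hd, h⟩ | ⟨_, _, _, _, h⟩) | ⟨_, _, _, _, _, _, _, h⟩) |
      ⟨_, _, _, _, _, _, _, _, _, h⟩) | ⟨_, _, _, _, _, _, _, _, _, _, _, h⟩)
    · simp only [Prod.mk.injEq, UVar.le.injEq] at h
      obtain ⟨⟨rfl, rfl⟩, rfl⟩ := h
      exact ⟨hd, e, he, rfl⟩
    all_goals simp at h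
  · rintro ⟨hd, e, he, rfl⟩
    exact .inl (.inl (.inl (.inl ⟨X, d, e, he, hd, rfl⟩)))

theorem varsOf_relabel {V A : Type} {rhs : List (A ⊕ V)} {zs : List (UVar V)}
    (h : zs.map UVar.base = varsOf rhs) : varsOf (relabel rhs zs) = zs := by
  induction rhs generalizing zs with
  | nil => simpa [varsOf, relabel] using h.symm
  | cons s rhs ih =>
    rcases s with a | Y
    · exact ih h
    · cases zs with
      | nil => simp [varsOf] at h
      | cons z zs =>
        have h' : zs.map UVar.base = varsOf rhs := (List.cons_eq_cons.mp h).2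
        exact congrArg (z :: ·) (ih h')

theorem map_base_relabel {V A : Type} {rhs : List (A ⊕ V)} {zs : List (UVar V)}
    (h : zs.map UVar.base = varsOf rhs) :
    (relabel rhs zs).map (Sum.map id UVar.base) = rhs := by
  induction rhs generalizing zs with
  | nil => rfl
  | cons s rhs ih =>
    rcases s with a | Y
    · exact congrArg (Sum.inl a :: ·) (ih h)
    · cases zs with
      | nil => simp [varsOf] at h
      | cons z zs =>
        have h' : z.base = Y ∧ zs.map UVar.base = varsOf rhs := List.cons_eq_cons.mp h
        simp [relabel, h'.1, ih h'.2]

namespace RawTree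

theorem yieldAux_map_base {V A : Type} (r : List (A ⊕ UVar V)) (ws : List (List A)) :
    yieldAux (r.map (Sum.map id UVar.base)) ws = yieldAux r ws := by
  induction r generalizing ws with
  | nil => rfl
  | cons s r ih =>
    rcases s with a | z
    · simp [yieldAux, ih]
    · cases ws <;> simp [yieldAux, ih]

theorem induction_children {V A : Type} {p : RawTree V A → Prop}
    (h : ∀ X rhs cs, (∀ c ∈ cs, p c) → p (node X rhs cs)) : ∀ t, p t
  | node X rhs cs => h X rhs cs fun c _ => induction_children h c
decreasing_by have := List.sizeOf_lt_of_mem ‹c ∈ cs›; simp; omega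

theorem isDTree_node {V A : Type} {G : CFG V A} {X Y : V} {rhs : List (A ⊕ V)}
    {cs : List (RawTree V A)} :
    IsDTree G X (node Y rhs cs) ↔
      X = Y ∧ (X, rhs) ∈ G.P ∧ List.Forall₂ (IsDTree G) (varsOf rhs) cs := by
  constructor
  · rintro ⟨hP, hch⟩
    exact ⟨rfl, hP, hch⟩
  · rintro ⟨rfl, hP, hch⟩
    exact ⟨hP, hch⟩

theorem yield_node {V A : Type} (X : V) (rhs : List (A ⊕ V)) (cs : List (RawTree V A)) :
    yield (node X rhs cs) = yieldAux rhs (cs.map yield) := by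
  rw [yield, List.attach_map_val]

theorem dim_node {V A : Type} (X : V) (rhs : List (A ⊕ V)) (cs : List (RawTree V A)) :
    dim (node X rhs cs) = nodeDim (cs.map dim) := by
  rw [dim, List.attach_map_val]
  rfl

/-- Forget the annotations of a derivation tree of an unfolded grammar, contracting the nodes
that are labelled by productions `X^{≤d} → X^{=e}`. -/
def forget {V A : Type} : RawTree (UVar V) A → RawTree V A
  | .node (.eq X _) rhs cs =>
    .node X (rhs.map (Sum.map id UVar.base)) (cs.attach.map fun c => forget c.1)
  | .node (.le X _) _ cs => (cs.attach.map fun c => forget c.1).headD (.node X [] [])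
decreasing_by all_goals have := List.sizeOf_lt_of_mem c.2; simp; omega

theorem forget_eq_node {V A : Type} (X : V) (d : ℕ) (r : List (A ⊕ UVar V))
    (cs : List (RawTree (UVar V) A)) :
    forget (node (.eq X d) r cs) = node X (r.map (Sum.map id UVar.base)) (cs.map forget) := by
  rw [forget, List.attach_map_val]

theorem forget_le_node {V A : Type} (X : V) (d : ℕ) (r : List (A ⊕ UVar V))
    (c : RawTree (UVar V) A) : forget (node (.le X d) r [c]) = forget c := by
  rw [forget, List.attach_map_val]
  rfl

theorem isDTree_unfold_eq {V A : Type} {G : CFG V A} {k d : ℕ} {X : V}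
    {t : RawTree (UVar V) A} :
    IsDTree (unfold G k) (.eq X d) t ↔ d ≤ k ∧ ∃ rhs zs cs, (X, rhs) ∈ G.P ∧
      Annotates d (varsOf rhs) zs ∧ List.Forall₂ (IsDTree (unfold G k)) zs cs ∧
      t = node (.eq X d) (relabel rhs zs) cs := by
  obtain ⟨Z, r, cs⟩ := t
  rw [isDTree_node]
  simp only [unfold, eq_mem_unfoldP]
  constructor
  · rintro ⟨rfl, ⟨hd, rhs, zs, hP, hA, rfl⟩, hcs⟩
    rw [varsOf_relabel hA.map_base] at hcs
    exact ⟨hd, rhs, zs, cs, hP, hA, hcs, rfl⟩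
  · rintro ⟨hd, rhs, zs, cs', hP, hA, hcs, h⟩
    obtain ⟨rfl, rfl, rfl⟩ := node.inj h
    refine ⟨rfl, ⟨hd, rhs, zs, hP, hA, rfl⟩, ?_⟩
    rwa [varsOf_relabel hA.map_base]

theorem isDTree_unfold_le {V A : Type} {G : CFG V A} {k d : ℕ} {X : V}
    {t : RawTree (UVar V) A} :
    IsDTree (unfold G k) (.le X d) t ↔ d ≤ k ∧ ∃ e ≤ d, ∃ c,
      IsDTree (unfold G k) (.eq X e) c ∧ t = node (.le X d) [Sum.inr (.eq X e)] [c] := by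
  obtain ⟨Z, r, cs⟩ := t
  rw [isDTree_node]
  simp only [unfold, le_mem_unfoldP]
  constructor
  · rintro ⟨rfl, ⟨hd, e, he, rfl⟩, hcs⟩
    rcases hcs with _ | ⟨h, h'⟩
    cases h'
    exact ⟨hd, e, he, _, h, rfl⟩
  · rintro ⟨hd, e, he, c, hc, h⟩
    obtain ⟨rfl, rfl, rfl⟩ := node.inj h
    exact ⟨rfl, ⟨hd, e, he, rfl⟩, .cons hc .nil⟩

theorem isDTree_forget {V A : Type} {G : CFG V A} {k : ℕ} (t : RawTree (UVar V) A) :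
    ∀ Z, IsDTree (unfold G k) Z t → IsDTree G Z.base (forget t) ∧ Z.Admits (dim (forget t)) ∧
      yield (forget t) = yield t := by
  induction t using induction_children with
  | h Z' r cs ih =>
  rintro (⟨X, d⟩ | ⟨X, d⟩) h
  · obtain ⟨_, e, he, c, hc, heq⟩ := isDTree_unfold_le.mp h
    obtain ⟨rfl, rfl, rfl⟩ := node.inj heq
    obtain ⟨h1, h2, h3⟩ := ih c (by simp) _ hc
    rw [forget_le_node]
    refine ⟨h1, ?_, by simp [h3, yield_node, yieldAux]⟩
    simp only [UVar.Admits] at h2 ⊢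
    omega
  · obtain ⟨_, rhs, zs, cs', hP, hA, hcs, heq⟩ := isDTree_unfold_eq.mp h
    obtain ⟨rfl, rfl, rfl⟩ := node.inj heq
    rw [forget_eq_node, yield_node, yield_node, dim_node, yieldAux_map_base,
      map_base_relabel hA.map_base, isDTree_node, List.map_map, List.map_map]
    have key := hcs.imp_of_mem_right fun z c hc hz => ih c hc z hz
    refine ⟨⟨rfl, hP, ?_⟩, ?_, ?_⟩
    · rw [← hA.map_base, List.forall₂_map_left_iff, List.forall₂_map_right_iff]
      exact key.imp fun _ _ h => h.1
    · refine hA.nodeDim_eq (List.forall₂_map_right_iff.mpr (key.imp fun _ _ h => h.2.1))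
    · congr 1
      clear h heq hA ih hcs
      induction key with
      | nil => rfl
      | cons h _ ih => simp [h.2.2, ih]

theorem forget_injOn {V A : Type} {G : CFG V A} {k : ℕ} (t : RawTree (UVar V) A) :
    ∀ Z t', IsDTree (unfold G k) Z t → IsDTree (unfold G k) Z t' → forget t = forget t' →
      t = t' := by
  induction t using induction_children with
  | h Z' r cs ih =>
  rintro (⟨X, d⟩ | ⟨X, d⟩) t' h h' hf
  · obtain ⟨_, e, he, c, hc, heq⟩ := isDTree_unfold_le.mp h
    obtain ⟨_, e', he', c', hc', rfl⟩ := isDTree_unfold_le.mp h'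
    obtain ⟨rfl, rfl, rfl⟩ := node.inj heq
    rw [forget_le_node, forget_le_node] at hf
    have h1 : dim (forget c) = e := (isDTree_forget c _ hc).2.1
    have h2 : dim (forget c') = e' := (isDTree_forget c' _ hc').2.1
    obtain rfl : e = e' := by rw [← h1, ← h2, hf]
    rw [ih c (by simp) _ c' hc hc' hf]
  · obtain ⟨_, rhs, zs, cs₁, hP, hA, hcs, heq⟩ := isDTree_unfold_eq.mp h
    obtain ⟨_, rhs', zs', cs', hP', hA', hcs', rfl⟩ := isDTree_unfold_eq.mp h'
    obtain ⟨rfl, rfl, rfl⟩ := node.inj heq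
    rw [forget_eq_node, forget_eq_node, map_base_relabel hA.map_base,
      map_base_relabel hA'.map_base] at hf
    obtain ⟨-, rfl, hch⟩ := node.inj hf
    have hadm : ∀ {zs : List (UVar V)} {cs}, List.Forall₂ (IsDTree (unfold G k)) zs cs →
        List.Forall₂ UVar.Admits zs ((cs.map forget).map dim) := fun h => by
      rw [List.map_map, List.forall₂_map_right_iff]
      exact h.imp fun z c hc => (isDTree_forget c z hc).2.1
    obtain rfl : zs = zs' := by
      rw [hA.eq_annotation (hadm hcs), hA'.eq_annotation (hadm hcs'), hch]
    congr 1
    clear h h' heq hA hA' hf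
    induction hcs generalizing cs' with
    | nil => cases hcs'; rfl
    | cons hc _ ih' =>
      rcases hcs' with _ | ⟨hc', hcs'⟩
      obtain ⟨hf₁, hf₂⟩ := List.cons_eq_cons.mp hch
      rw [ih _ (by simp) _ _ hc hc' hf₁, ih' (fun c hc => ih c (by simp [hc])) _ hf₂ hcs']

theorem exists_forget_eq {V A : Type} {G : CFG V A} {k : ℕ} (t : RawTree V A) :
    ∀ Z : UVar V, Z.bound ≤ k → IsDTree G Z.base t → Z.Admits (dim t) →
      ∃ t', IsDTree (unfold G k) Z t' ∧ forget t' = t := by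
  induction t using induction_children with
  | h Y rhs cs ih =>
  have heq : ∀ X d, d ≤ k → IsDTree G X (node Y rhs cs) → dim (node Y rhs cs) = d →
      ∃ t', IsDTree (unfold G k) (.eq X d) t' ∧ forget t' = node Y rhs cs := by
    intro X d hdk h hd
    obtain ⟨rfl, hP, hcs⟩ := isDTree_node.mp h
    obtain ⟨zs, hA, hzs, hb⟩ := exists_annotates (ys := varsOf rhs) (ns := cs.map dim)
      (by simpa using hcs.length_eq)
    rw [← dim_node X rhs, hd] at hA hb
    have hlift : List.Forall₂ (fun z c => ∃ c', IsDTree (unfold G k) z c' ∧ forget c' = c)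
        zs cs := by
      rw [← hA.map_base, List.forall₂_map_left_iff] at hcs
      rw [List.forall₂_map_right_iff] at hzs
      rw [List.forall₂_iff_get] at hcs hzs ⊢
      exact ⟨hcs.1, fun i h₁ h₂ => ih _ (List.get_mem _ _) _
        ((hb _ (List.get_mem _ _)).trans hdk) (hcs.2 i h₁ h₂) (hzs.2 i h₁ h₂)⟩
    obtain ⟨cs', hcs', hf⟩ : ∃ cs', List.Forall₂ (IsDTree (unfold G k)) zs cs' ∧
        cs'.map forget = cs := by
      clear hA hzs hb ih h hd hcs
      induction hlift with
      | nil => exact ⟨[], .nil, rfl⟩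
      | cons h _ ih =>
        obtain ⟨c', hc', rfl⟩ := h
        obtain ⟨cs', hcs', rfl⟩ := ih
        exact ⟨c' :: cs', .cons hc' hcs', rfl⟩
    refine ⟨_, isDTree_unfold_eq.mpr ⟨hdk, rhs, zs, cs', hP, hA, hcs', rfl⟩, ?_⟩
    rw [forget_eq_node, map_base_relabel hA.map_base, hf]
  rintro (⟨X, d⟩ | ⟨X, d⟩) hdk h hd
  · simp only [UVar.bound, UVar.Admits] at hdk hd
    obtain ⟨c, hc, hf⟩ := heq X _ (hd.trans hdk) h rfl
    exact ⟨_, isDTree_unfold_le.mpr ⟨hdk, _, hd, c, hc, rfl⟩, by rw [forget_le_node, hf]⟩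
  · exact heq X d hdk h hd

/-- Forgetting annotations is a yield-preserving bijection from the derivation trees of an
annotated variable to the derivation trees of its base whose dimension it admits. -/
theorem exists_equiv_isDTree_unfold {V A : Type} (G : CFG V A) {k : ℕ} (Z : UVar V)
    (hZ : Z.bound ≤ k) :
    ∃ f : {t : RawTree (UVar V) A // IsDTree (unfold G k) Z t} ≃
        {t : RawTree V A // IsDTree G Z.base t ∧ Z.Admits (dim t)},
      ∀ t, yield (f t).1 = yield t.1 := by
  refine ⟨Equiv.ofBijective (fun t => ⟨forget t.1, (isDTree_forget t.1 Z t.2).1,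
    (isDTree_forget t.1 Z t.2).2.1⟩) ⟨?_, ?_⟩, fun t => (isDTree_forget t.1 Z t.2).2.2⟩
  · intro t t' h
    exact Subtype.ext (forget_injOn t.1 Z t'.1 t.2 t'.2 (Subtype.ext_iff.mp h))
  · rintro ⟨t, ht, hd⟩
    obtain ⟨t', ht', rfl⟩ := exists_forget_eq t Z hZ ht hd
    exact ⟨⟨t', ht'⟩, rfl⟩

end RawTree

/-- There is a yield-preserving bijection between the `(G^{≤k}, X^{=d})`-derivation
trees and the `(G,X)`-derivation trees of dimension exactly `d`, and likewise between
the `(G^{≤k}, X^{≤d})`-derivation trees and the `(G,X)`-derivation trees of dimension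
at most `d`. -/
theorem unfold_yield_bijection {V A : Type} [Fintype V] [Fintype A]
    (G : CFG V A) (hGfin : G.P.Finite) (k : ℕ) (X : V) (d : ℕ) (hd : d ≤ k) :
    (∃ f : {t : RawTree (UVar V) A // IsDTree (unfold G k) (UVar.eq X d) t} ≃
           {t : RawTree V A // IsDTree G X t ∧ dim t = d},
       ∀ t, yield (f t).1 = yield t.1) ∧
    (∃ g : {t : RawTree (UVar V) A // IsDTree (unfold G k) (UVar.le X d) t} ≃
           {t : RawTree V A // IsDTree G X t ∧ dim t ≤ d},
       ∀ t, yield (g t).1 = yield t.1) := by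
  exact ⟨exists_equiv_isDTree_unfold G (.eq X d) hd, exists_equiv_isDTree_unfold G (.le X d) hd⟩
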